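/- Let s : (0,∞) → (0,∞) be a continuous, strictly decreasing surjection that is self-inverse, i.e. s(s(x)) = x for all x > 0. Let f : [0,∞) → ℝ be a continuous function such that x ↦ f((x − s(x))²) is integrable on (0,∞) and y ↦ f(y²) is integrable on (0,∞). Then ∫₀^∞ f((x − s(x))²) dx = ∫₀^∞ f(y²) dy. -/

import Mathlib

open MeasureTheory

section SelfInverse

variable {s : ℝ → ℝ}

lemma strictMonoOn_id_sub_of_strictAntiOn (hs : StrictAntiOn s (Set.Ioi 0)) :
    StrictMonoOn (fun x => x - s x) (Set.Ioi 0) := by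
  intro x hx y hy hxy
  have := hs hx hy hxy
  simp only
  linarith

lemma exists_sub_self_inverse_eq (hs_cont : ContinuousOn s (Set.Ioi 0))
    (hs_anti : StrictAntiOn s (Set.Ioi 0)) (hs_maps : Set.MapsTo s (Set.Ioi 0) (Set.Ioi 0))
    (hs_inv : ∀ x : ℝ, 0 < x → s (s x) = x) (c : ℝ) : ∃ x, 0 < x ∧ x - s x = c := by
  have large (c : ℝ) : ∃ x, 0 < x ∧ c ≤ x - s x := by
    have h1 : 0 < s 1 := hs_maps (Set.mem_Ioi.2 one_pos)
    have hx : 1 < 1 + |c| + s 1 := by have := abs_nonneg c; linarith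
    refine ⟨1 + |c| + s 1, by linarith, ?_⟩
    have := hs_anti (Set.mem_Ioi.2 one_pos) (Set.mem_Ioi.2 (one_pos.trans hx)) hx
    have := le_abs_self c
    linarith
  obtain ⟨v, hv, hcv⟩ := large c
  obtain ⟨u, hu, hcu⟩ := large (-c)
  have hsu : s u ∈ Set.Ioi 0 := hs_maps hu
  have hlow : s u - s (s u) ≤ c := by rw [hs_inv u hu]; linarith
  obtain ⟨x, hx, hxc⟩ := isPreconnected_Ioi.intermediate_value hsu (Set.mem_Ioi.2 hv)
    (continuousOn_id.sub hs_cont) ⟨hlow, hcv⟩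
  exact ⟨x, hx, hxc⟩

/-- The image of Lebesgue measure on the half-line under `x ↦ x - s x`, plus its reflection,
is Lebesgue measure on the line. -/
lemma map_sub_self_inverse_add_map_neg (hs_cont : ContinuousOn s (Set.Ioi 0))
    (hs_anti : StrictAntiOn s (Set.Ioi 0)) (hs_maps : Set.MapsTo s (Set.Ioi 0) (Set.Ioi 0))
    (hs_inv : ∀ x : ℝ, 0 < x → s (s x) = x) :
    (volume.restrict (Set.Ioi (0 : ℝ))).map (fun x => x - s x) +
      (volume.restrict (Set.Ioi (0 : ℝ))).map (fun x => -(x - s x)) = volume := by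
  have hcont : ContinuousOn (fun x => x - s x) (Set.Ioi 0) := continuousOn_id.sub hs_cont
  have hmono := strictMonoOn_id_sub_of_strictAntiOn hs_anti
  have preimage {u v : ℝ} (hu : 0 < u) (hv : 0 < v) :
      (fun x => x - s x) ⁻¹' Set.Ioo (u - s u) (v - s v) ∩ Set.Ioi 0 = Set.Ioo u v := by
    ext x
    constructor
    · rintro ⟨⟨hux, hxv⟩, hx⟩
      exact ⟨(hmono.lt_iff_lt hu hx).1 hux, (hmono.lt_iff_lt hx hv).1 hxv⟩
    · rintro ⟨hux, hxv⟩
      have hx : x ∈ Set.Ioi 0 := hu.trans hux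
      exact ⟨⟨hmono hu hx hux, hmono hx hv hxv⟩, hx⟩
  symm
  refine Real.measure_ext_Ioo_rat fun a b => ?_
  obtain hab | hab := le_or_gt (b : ℝ) a
  · simp [Set.Ioo_eq_empty_of_le hab]
  obtain ⟨u, hu, hua⟩ := exists_sub_self_inverse_eq hs_cont hs_anti hs_maps hs_inv a
  obtain ⟨v, hv, hvb⟩ := exists_sub_self_inverse_eq hs_cont hs_anti hs_maps hs_inv b
  have huv : u < v := (hmono.lt_iff_lt hu hv).1 (by simpa only [hua, hvb] using hab)
  have hsuv : s v < s u := hs_anti hu hv huv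
  have hneg : (fun x => -(x - s x)) ⁻¹' Set.Ioo (a : ℝ) b =
      (fun x => x - s x) ⁻¹' Set.Ioo (s v - s (s v)) (s u - s (s u)) := by
    ext x
    rw [hs_inv u hu, hs_inv v hv]
    simp only [Set.mem_preimage, Set.mem_Ioo]
    constructor <;> rintro ⟨h, h'⟩ <;> constructor <;> linarith
  have hneg_meas : AEMeasurable (fun x => -(x - s x)) (volume.restrict (Set.Ioi 0)) :=
    (hcont.aemeasurable measurableSet_Ioi).neg
  rw [Measure.add_apply,
    Measure.map_apply_of_aemeasurable (hcont.aemeasurable measurableSet_Ioi) measurableSet_Ioo,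
    Measure.map_apply_of_aemeasurable hneg_meas measurableSet_Ioo,
    Measure.restrict_apply' measurableSet_Ioi, Measure.restrict_apply' measurableSet_Ioi, hneg,
    preimage (hs_maps hv) (hs_maps hu), ← hua, ← hvb, preimage hu hv, Real.volume_Ioo,
    Real.volume_Ioo, Real.volume_Ioo, ← ENNReal.ofReal_add (by linarith) (by linarith)]
  congr 1
  ring

end SelfInverse

theorem extended_cauchy_schlomilch (s : ℝ → ℝ)
    (hs_cont : ContinuousOn s (Set.Ioi 0))
    (hs_anti : StrictAntiOn s (Set.Ioi 0))
    (hs_maps : Set.MapsTo s (Set.Ioi 0) (Set.Ioi 0))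
    (hs_surj : Set.SurjOn s (Set.Ioi 0) (Set.Ioi 0))
    (hs_inv : ∀ x : ℝ, 0 < x → s (s x) = x)
    (f : ℝ → ℝ) (hf : ContinuousOn f (Set.Ici 0))
    (h1 : IntegrableOn (fun x : ℝ => f ((x - s x) ^ 2)) (Set.Ioi 0))
    (h2 : IntegrableOn (fun y : ℝ => f (y ^ 2)) (Set.Ioi 0)) :
    ∫ x in Set.Ioi (0 : ℝ), f ((x - s x) ^ 2) =
      ∫ y in Set.Ioi (0 : ℝ), f (y ^ 2) := by
  have hg : Continuous fun y : ℝ => f (y ^ 2) :=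
    hf.comp_continuous (continuous_pow 2) fun y => sq_nonneg y
  have hcont : ContinuousOn (fun x => x - s x) (Set.Ioi 0) := continuousOn_id.sub hs_cont
  have hm : AEMeasurable (fun x => x - s x) (volume.restrict (Set.Ioi 0)) :=
    hcont.aemeasurable measurableSet_Ioi
  have hm' : AEMeasurable (fun x => -(x - s x)) (volume.restrict (Set.Ioi 0)) := hm.neg
  have heven : ∫ y, f (y ^ 2) = 2 * ∫ y in Set.Ioi (0 : ℝ), f (y ^ 2) := by
    rw [← integral_comp_abs (f := fun y : ℝ => f (y ^ 2))]
    exact integral_congr_ae (.of_forall fun y => congrArg f (sq_abs y).symm)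
  have hsum : ∫ y, f (y ^ 2) = 2 * ∫ x in Set.Ioi (0 : ℝ), f ((x - s x) ^ 2) := by
    conv_lhs => rw [← map_sub_self_inverse_add_map_neg hs_cont hs_anti hs_maps hs_inv]
    rw [integral_add_measure
        ((integrable_map_measure hg.aestronglyMeasurable hm).2 h1)
        ((integrable_map_measure hg.aestronglyMeasurable hm').2
          (by simpa only [Function.comp_def, neg_sq] using h1.integrable)),
      integral_map hm hg.aestronglyMeasurable, integral_map hm' hg.aestronglyMeasurable]
    simp only [neg_sq]
    ring
  linarith
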